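/- arXiv:1603.08766 — 3 statements merged into one kernel-verified Lean document; each statement's English description precedes it below -/
import Mathlib

section
/- Let ε1, ε2 > 0, q ≠ 0, R > 0, T > 0, let c1, c2 : [0,1] → ℝ be continuous, and let Q1, Q2, Pf1, Pf2 : [0,1]² → ℝ be continuous symmetric kernels. Suppose u*, v* ∈ C¹([0,1]×[0,T]) and U* ∈ C([0,T]) solve the state system, and suppose λ1, λ2 ∈ C¹([0,1]×[0,T]) solve the adjoint system associated with (u*, v*). If moreover U*(t) = -(ε2/R) λ2(1,t) for all t ∈ [0,T], then for every admissible variation (δu, δv, δU), the function ε ↦ J(u* + ε δu, v* + ε δv, U* + ε δU) is differentiable at ε = 0 with derivative equal to 0. -/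
open MeasureTheory intervalIntegral Set

/-- `f : ℝ → ℝ → ℝ` (space, time) is C¹ on `[0,1] × [0,T]`, with spatial partial
derivative `fx` and temporal partial derivative `ft`, both continuous on the rectangle. -/
def C1On2 (T : ℝ) (f fx ft : ℝ → ℝ → ℝ) : Prop :=
  (∀ x ∈ Icc (0:ℝ) 1, ∀ t ∈ Icc (0:ℝ) T,
      HasDerivWithinAt (fun s => f s t) (fx x t) (Icc (0:ℝ) 1) x ∧
      HasDerivWithinAt (fun s => f x s) (ft x t) (Icc (0:ℝ) T) t) ∧
  ContinuousOn (Function.uncurry f) (Icc (0:ℝ) 1 ×ˢ Icc (0:ℝ) T) ∧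
  ContinuousOn (Function.uncurry fx) (Icc (0:ℝ) 1 ×ˢ Icc (0:ℝ) T) ∧
  ContinuousOn (Function.uncurry ft) (Icc (0:ℝ) 1 ×ˢ Icc (0:ℝ) T)

/-- `(u, v, U)` solves the state system
`uₜ = -ε₁ uₓ + c₁(x) v`, `vₜ = ε₂ vₓ + c₂(x) u` on `[0,1] × [0,T]`,
with boundary conditions `u(0,t) = q v(0,t)`, `v(1,t) = U(t)`,
where `u, v ∈ C¹([0,1] × [0,T])` and `U ∈ C([0,T])`. -/
def SolvesState (ε1 ε2 q T : ℝ) (c1 c2 : ℝ → ℝ) (u v : ℝ → ℝ → ℝ) (U : ℝ → ℝ) : Prop :=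
  ∃ ux ut vx vt : ℝ → ℝ → ℝ,
    C1On2 T u ux ut ∧ C1On2 T v vx vt ∧ ContinuousOn U (Icc (0:ℝ) T) ∧
    (∀ x ∈ Icc (0:ℝ) 1, ∀ t ∈ Icc (0:ℝ) T,
      ut x t = -ε1 * ux x t + c1 x * v x t ∧
      vt x t = ε2 * vx x t + c2 x * u x t) ∧
    (∀ t ∈ Icc (0:ℝ) T, u 0 t = q * v 0 t ∧ v 1 t = U t)

/-- `(λ₁, λ₂)` solves the adjoint (co-state) system associated with `(u, v)`:
`-λ₁ₜ = ε₁ λ₁ₓ + c₂(x) λ₂ + Q₁(u(·,t))(x)`, `-λ₂ₜ = -ε₂ λ₂ₓ + c₁(x) λ₁ + Q₂(v(·,t))(x)`,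
with boundary conditions `λ₁(1,t) = 0`, `λ₂(0,t) = q (ε₁/ε₂) λ₁(0,t)` and terminal
conditions `λ₁(x,T) = Pf₁(u(·,T))(x)`, `λ₂(x,T) = Pf₂(v(·,T))(x)`,
where `λ₁, λ₂ ∈ C¹([0,1] × [0,T])`. -/
def SolvesAdjoint (ε1 ε2 q T : ℝ) (c1 c2 : ℝ → ℝ) (Q1 Q2 Pf1 Pf2 : ℝ → ℝ → ℝ)
    (u v lam1 lam2 : ℝ → ℝ → ℝ) : Prop :=
  ∃ lam1x lam1t lam2x lam2t : ℝ → ℝ → ℝ,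
    C1On2 T lam1 lam1x lam1t ∧ C1On2 T lam2 lam2x lam2t ∧
    (∀ x ∈ Icc (0:ℝ) 1, ∀ t ∈ Icc (0:ℝ) T,
      -lam1t x t = ε1 * lam1x x t + c2 x * lam2 x t
          + (∫ y in (0:ℝ)..1, Q1 x y * u y t) ∧
      -lam2t x t = -ε2 * lam2x x t + c1 x * lam1 x t
          + ∫ y in (0:ℝ)..1, Q2 x y * v y t) ∧
    (∀ t ∈ Icc (0:ℝ) T, lam1 1 t = 0 ∧ lam2 0 t = q * (ε1 / ε2) * lam1 0 t) ∧
    (∀ x ∈ Icc (0:ℝ) 1,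
      lam1 x T = (∫ y in (0:ℝ)..1, Pf1 x y * u y T) ∧
      lam2 x T = ∫ y in (0:ℝ)..1, Pf2 x y * v y T)

/-- `(δu, δv, δU)` is an admissible variation: `δu, δv ∈ C¹([0,1] × [0,T])`,
`δU ∈ C([0,T])`, satisfying the linearized dynamics `δuₜ = -ε₁ δuₓ + c₁(x) δv`,
`δvₜ = ε₂ δvₓ + c₂(x) δu`, the boundary conditions `δu(0,t) = q δv(0,t)`,
`δv(1,t) = δU(t)`, and the zero initial conditions `δu(x,0) = δv(x,0) = 0`. -/
def Admissible (ε1 ε2 q T : ℝ) (c1 c2 : ℝ → ℝ) (du dv : ℝ → ℝ → ℝ) (dU : ℝ → ℝ) : Prop :=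
  ∃ dux dut dvx dvt : ℝ → ℝ → ℝ,
    C1On2 T du dux dut ∧ C1On2 T dv dvx dvt ∧ ContinuousOn dU (Icc (0:ℝ) T) ∧
    (∀ x ∈ Icc (0:ℝ) 1, ∀ t ∈ Icc (0:ℝ) T,
      dut x t = -ε1 * dux x t + c1 x * dv x t ∧
      dvt x t = ε2 * dvx x t + c2 x * du x t) ∧
    (∀ t ∈ Icc (0:ℝ) T, du 0 t = q * dv 0 t ∧ dv 1 t = dU t) ∧
    (∀ x ∈ Icc (0:ℝ) 1, du x 0 = 0 ∧ dv x 0 = 0)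

/-- The quadratic cost functional
`J(u,v,U) = ½ ∫₀ᵀ [⟨u, Q₁(u)⟩ + ⟨v, Q₂(v)⟩ + R U(t)²] dt
  + ½ ⟨u(·,T), Pf₁(u(·,T))⟩ + ½ ⟨v(·,T), Pf₂(v(·,T))⟩`,
where `K(f)(x) = ∫₀¹ K(x,y) f(y) dy` and `⟨f,g⟩ = ∫₀¹ f(x) g(x) dx`. -/
noncomputable def cost (T R : ℝ) (Q1 Q2 Pf1 Pf2 : ℝ → ℝ → ℝ)
    (u v : ℝ → ℝ → ℝ) (U : ℝ → ℝ) : ℝ :=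
  (1/2) * (∫ t in (0:ℝ)..T,
      ((∫ x in (0:ℝ)..1, u x t * ∫ y in (0:ℝ)..1, Q1 x y * u y t)
        + (∫ x in (0:ℝ)..1, v x t * ∫ y in (0:ℝ)..1, Q2 x y * v y t)
        + R * U t ^ 2))
    + (1/2) * (∫ x in (0:ℝ)..1, u x T * ∫ y in (0:ℝ)..1, Pf1 x y * u y T)
    + (1/2) * (∫ x in (0:ℝ)..1, v x T * ∫ y in (0:ℝ)..1, Pf2 x y * v y T)

/-- The integral of a jointly continuous function over a compact interval depends continuously
on the parameter. -/
lemma continuousOn_intervalIntegral_of_continuousOn {X : Type*} [TopologicalSpace X]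
    [FirstCountableTopology X] {S : Set X} {F : X → ℝ → ℝ} {a b : ℝ} (hab : a ≤ b)
    (hF : ContinuousOn (Function.uncurry F) (S ×ˢ Icc a b)) :
    ContinuousOn (fun p => ∫ y in a..b, F p y) S := by
  rw [continuousOn_iff_continuous_domRestrict]
  have hc : Continuous (Function.uncurry fun (p : S) (y : ℝ) => F p (projIcc a b hab y)) :=
    hF.comp_continuous (f := fun z : S × ℝ => ((z.1 : X), (projIcc a b hab z.2 : ℝ)))
      ((continuous_subtype_val.comp continuous_fst).prodMk
        (continuous_subtype_val.comp (continuous_projIcc.comp continuous_snd)))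
      fun z => ⟨z.1.2, (projIcc a b hab z.2).2⟩
  refine (continuous_parametric_intervalIntegral_of_continuous' (μ := volume) hc a b).congr
    fun p => integral_congr fun y hy => ?_
  rw [uIcc_of_le hab] at hy
  simp [projIcc_of_mem hab hy]

/-- The fundamental theorem of calculus with one-sided derivatives at the end points. -/
lemma integral_eq_sub_of_hasDerivWithinAt_Icc {f f' : ℝ → ℝ} {a b : ℝ} (hab : a ≤ b)
    (hf : ∀ x ∈ Icc a b, HasDerivWithinAt f (f' x) (Icc a b) x)
    (hf' : ContinuousOn f' (Icc a b)) : ∫ x in a..b, f' x = f b - f a :=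
  integral_eq_sub_of_hasDerivAt_of_le hab (fun x hx => (hf x hx).continuousWithinAt)
    (fun x hx => (hf x (Ioo_subset_Icc_self hx)).hasDerivAt (Icc_mem_nhds hx.1 hx.2))
    (hf'.intervalIntegrable_of_Icc hab)

lemma continuousOn_slice_left {f : ℝ → ℝ → ℝ} {S S' : Set ℝ}
    (hf : ContinuousOn (Function.uncurry f) (S ×ˢ S')) {t : ℝ} (ht : t ∈ S') :
    ContinuousOn (fun x => f x t) S :=
  hf.comp (f := fun x => (x, t)) (by fun_prop) fun _ hx => ⟨hx, ht⟩

lemma continuousOn_slice_right {f : ℝ → ℝ → ℝ} {S S' : Set ℝ}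
    (hf : ContinuousOn (Function.uncurry f) (S ×ˢ S')) {x : ℝ} (hx : x ∈ S) :
    ContinuousOn (fun t => f x t) S' :=
  hf.comp (f := fun t => (x, t)) (by fun_prop) fun _ ht => ⟨hx, ht⟩

lemma continuousOn_swap {f : ℝ → ℝ → ℝ} {S S' : Set ℝ}
    (hf : ContinuousOn (Function.uncurry f) (S ×ˢ S')) :
    ContinuousOn (Function.uncurry fun t x => f x t) (S' ×ˢ S) :=
  hf.comp continuous_swap.continuousOn fun _ hp => ⟨hp.2, hp.1⟩

lemma continuousOn_kernel_apply {K f : ℝ → ℝ → ℝ} {S : Set ℝ}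
    (hK : ContinuousOn (Function.uncurry K) (Icc (0:ℝ) 1 ×ˢ Icc (0:ℝ) 1))
    (hf : ContinuousOn (Function.uncurry f) (Icc (0:ℝ) 1 ×ˢ S)) :
    ContinuousOn (Function.uncurry fun x t => ∫ y in (0:ℝ)..1, K x y * f y t)
      (Icc (0:ℝ) 1 ×ˢ S) := by
  refine continuousOn_intervalIntegral_of_continuousOn
    (F := fun (p : ℝ × ℝ) y => K p.1 y * f y p.2) zero_le_one ?_
  exact (hK.comp (f := fun z : (ℝ × ℝ) × ℝ => (z.1.1, z.2)) (by fun_prop)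
      fun z hz => ⟨hz.1.1, hz.2⟩).mul
    (hf.comp (f := fun z : (ℝ × ℝ) × ℝ => (z.2, z.1.2)) (by fun_prop)
      fun z hz => ⟨hz.2, hz.1.2⟩)

/-- The bilinear form `⟨f, K(g)⟩` on `[0,1]`. -/
noncomputable def kernelForm (K : ℝ → ℝ → ℝ) (f g : ℝ → ℝ) : ℝ :=
  ∫ x in (0:ℝ)..1, f x * ∫ y in (0:ℝ)..1, K x y * g y

lemma continuousOn_kernel_apply_slice {K : ℝ → ℝ → ℝ} {g : ℝ → ℝ}
    (hK : ContinuousOn (Function.uncurry K) (Icc (0:ℝ) 1 ×ˢ Icc (0:ℝ) 1))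
    (hg : ContinuousOn g (Icc (0:ℝ) 1)) :
    ContinuousOn (fun x => ∫ y in (0:ℝ)..1, K x y * g y) (Icc (0:ℝ) 1) :=
  continuousOn_slice_left (t := 0) (S' := univ)
    (continuousOn_kernel_apply (f := fun y _ => g y) hK
      (hg.comp continuousOn_fst fun _ hp => hp.1)) (mem_univ _)

lemma kernelForm_comm {K : ℝ → ℝ → ℝ} {f g : ℝ → ℝ}
    (hK : ContinuousOn (Function.uncurry K) (Icc (0:ℝ) 1 ×ˢ Icc (0:ℝ) 1))
    (hsym : ∀ x ∈ Icc (0:ℝ) 1, ∀ y ∈ Icc (0:ℝ) 1, K x y = K y x)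
    (hf : ContinuousOn f (Icc (0:ℝ) 1)) (hg : ContinuousOn g (Icc (0:ℝ) 1)) :
    kernelForm K f g = kernelForm K g f := by
  simp only [kernelForm, ← intervalIntegral.integral_const_mul]
  rw [intervalIntegral_intervalIntegral_swap]
  · refine integral_congr fun y hy => integral_congr fun x hx => ?_
    rw [uIcc_of_le zero_le_one] at hx hy
    simp only [hsym x hx y hy]
    ring
  · rw [uIoc_of_le zero_le_one]
    refine IntegrableOn.mono_set ?_ (prod_mono Ioc_subset_Icc_self Ioc_subset_Icc_self)
    refine ContinuousOn.integrableOn_compact (isCompact_Icc.prod isCompact_Icc) ?_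
    exact (hf.comp continuousOn_fst fun _ hp => hp.1).mul
      (hK.mul (hg.comp continuousOn_snd fun _ hp => hp.2))

lemma kernelForm_add_smul_self {K : ℝ → ℝ → ℝ} {f g : ℝ → ℝ}
    (hK : ContinuousOn (Function.uncurry K) (Icc (0:ℝ) 1 ×ˢ Icc (0:ℝ) 1))
    (hsym : ∀ x ∈ Icc (0:ℝ) 1, ∀ y ∈ Icc (0:ℝ) 1, K x y = K y x)
    (hf : ContinuousOn f (Icc (0:ℝ) 1)) (hg : ContinuousOn g (Icc (0:ℝ) 1)) (e : ℝ) :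
    kernelForm K (fun x => f x + e * g x) (fun x => f x + e * g x)
      = kernelForm K f f + e * (2 * kernelForm K g f) + e ^ 2 * kernelForm K g g := by
  have hKf := continuousOn_kernel_apply_slice hK hf
  have hKg := continuousOn_kernel_apply_slice hK hg
  have hinner : ∀ x ∈ Icc (0:ℝ) 1, ∫ y in (0:ℝ)..1, K x y * (f y + e * g y)
      = (∫ y in (0:ℝ)..1, K x y * f y) + e * ∫ y in (0:ℝ)..1, K x y * g y := by
    intro x hx
    have hKx := continuousOn_slice_right hK hx
    rw [← intervalIntegral.integral_const_mul, ← intervalIntegral.integral_add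
      ((hKx.fun_mul hf).intervalIntegrable_of_Icc zero_le_one)
      (((hKx.fun_mul hg).const_mul e).intervalIntegrable_of_Icc zero_le_one)]
    exact integral_congr fun y _ => by ring
  have hsplit : kernelForm K (fun x => f x + e * g x) (fun x => f x + e * g x)
      = kernelForm K f f + e * kernelForm K f g
        + (e * kernelForm K g f + e ^ 2 * kernelForm K g g) := by
    have h1 := (hf.fun_mul hKf).intervalIntegrable_of_Icc (μ := volume) zero_le_one
    have h2 := ((hf.fun_mul hKg).const_mul e).intervalIntegrable_of_Icc (μ := volume) zero_le_one
    have h3 := ((hg.fun_mul hKf).const_mul e).intervalIntegrable_of_Icc (μ := volume) zero_le_one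
    have h4 := ((hg.fun_mul hKg).const_mul (e ^ 2)).intervalIntegrable_of_Icc (μ := volume)
      zero_le_one
    simp only [kernelForm, ← intervalIntegral.integral_const_mul e,
      ← intervalIntegral.integral_const_mul (e ^ 2)]
    rw [← intervalIntegral.integral_add h1 h2, ← intervalIntegral.integral_add h3 h4,
      ← intervalIntegral.integral_add (h1.add h2) (h3.add h4)]
    refine integral_congr fun x hx => ?_
    rw [uIcc_of_le zero_le_one] at hx
    simp only [hinner x hx]
    ring
  rw [hsplit, kernelForm_comm hK hsym hf hg]
  ring

lemma continuousOn_kernelForm {K f g : ℝ → ℝ → ℝ} {S : Set ℝ}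
    (hK : ContinuousOn (Function.uncurry K) (Icc (0:ℝ) 1 ×ˢ Icc (0:ℝ) 1))
    (hf : ContinuousOn (Function.uncurry f) (Icc (0:ℝ) 1 ×ˢ S))
    (hg : ContinuousOn (Function.uncurry g) (Icc (0:ℝ) 1 ×ˢ S)) :
    ContinuousOn (fun t => kernelForm K (fun x => f x t) (fun x => g x t)) S :=
  continuousOn_intervalIntegral_of_continuousOn zero_le_one
    (continuousOn_swap (f := fun x t => f x t * ∫ y in (0:ℝ)..1, K x y * g y t)
      (hf.mul (continuousOn_kernel_apply hK hg)))

/-- The cost along an affine line of trajectories is a quadratic polynomial, whose linear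
coefficient is the first variation. -/
lemma exists_cost_add_smul_eq {R T : ℝ} (hT : 0 ≤ T) {Q1 Q2 Pf1 Pf2 : ℝ → ℝ → ℝ}
    (hQ1 : ContinuousOn (Function.uncurry Q1) (Icc (0:ℝ) 1 ×ˢ Icc (0:ℝ) 1))
    (hQ2 : ContinuousOn (Function.uncurry Q2) (Icc (0:ℝ) 1 ×ˢ Icc (0:ℝ) 1))
    (hPf1 : ContinuousOn (Function.uncurry Pf1) (Icc (0:ℝ) 1 ×ˢ Icc (0:ℝ) 1))
    (hPf2 : ContinuousOn (Function.uncurry Pf2) (Icc (0:ℝ) 1 ×ˢ Icc (0:ℝ) 1))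
    (hQ1sym : ∀ x ∈ Icc (0:ℝ) 1, ∀ y ∈ Icc (0:ℝ) 1, Q1 x y = Q1 y x)
    (hQ2sym : ∀ x ∈ Icc (0:ℝ) 1, ∀ y ∈ Icc (0:ℝ) 1, Q2 x y = Q2 y x)
    (hPf1sym : ∀ x ∈ Icc (0:ℝ) 1, ∀ y ∈ Icc (0:ℝ) 1, Pf1 x y = Pf1 y x)
    (hPf2sym : ∀ x ∈ Icc (0:ℝ) 1, ∀ y ∈ Icc (0:ℝ) 1, Pf2 x y = Pf2 y x)
    {u v du dv : ℝ → ℝ → ℝ} {U dU : ℝ → ℝ}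
    (hu : ContinuousOn (Function.uncurry u) (Icc (0:ℝ) 1 ×ˢ Icc (0:ℝ) T))
    (hv : ContinuousOn (Function.uncurry v) (Icc (0:ℝ) 1 ×ˢ Icc (0:ℝ) T))
    (hU : ContinuousOn U (Icc (0:ℝ) T))
    (hdu : ContinuousOn (Function.uncurry du) (Icc (0:ℝ) 1 ×ˢ Icc (0:ℝ) T))
    (hdv : ContinuousOn (Function.uncurry dv) (Icc (0:ℝ) 1 ×ˢ Icc (0:ℝ) T))
    (hdU : ContinuousOn dU (Icc (0:ℝ) T)) :
    ∃ a b : ℝ, ∀ e : ℝ, cost T R Q1 Q2 Pf1 Pf2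
        (fun x t => u x t + e * du x t) (fun x t => v x t + e * dv x t)
        (fun t => U t + e * dU t)
      = a + e * ((∫ t in (0:ℝ)..T,
            (kernelForm Q1 (fun x => du x t) (fun x => u x t)
              + kernelForm Q2 (fun x => dv x t) (fun x => v x t) + R * (U t * dU t)))
          + kernelForm Pf1 (fun x => du x T) (fun x => u x T)
          + kernelForm Pf2 (fun x => dv x T) (fun x => v x T)) + e ^ 2 * b := by
  have hTmem : T ∈ Icc (0:ℝ) T := right_mem_Icc.2 hT
  let L (f g f' g' : ℝ → ℝ → ℝ) (w w' : ℝ → ℝ) (t : ℝ) : ℝ :=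
    kernelForm Q1 (fun x => f x t) (fun x => g x t)
      + kernelForm Q2 (fun x => f' x t) (fun x => g' x t) + R * (w t * w' t)
  have h0 : IntervalIntegrable (L u u v v U U) volume 0 T :=
    (((continuousOn_kernelForm hQ1 hu hu).add (continuousOn_kernelForm hQ2 hv hv)).add
      ((hU.mul hU).const_mul R)).intervalIntegrable_of_Icc hT
  have h1 : IntervalIntegrable (L du u dv v U dU) volume 0 T :=
    (((continuousOn_kernelForm hQ1 hdu hu).add (continuousOn_kernelForm hQ2 hdv hv)).add
      ((hU.mul hdU).const_mul R)).intervalIntegrable_of_Icc hT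
  have h2 : IntervalIntegrable (L du du dv dv dU dU) volume 0 T :=
    (((continuousOn_kernelForm hQ1 hdu hdu).add (continuousOn_kernelForm hQ2 hdv hdv)).add
      ((hdU.mul hdU).const_mul R)).intervalIntegrable_of_Icc hT
  refine ⟨(1/2) * ((∫ t in (0:ℝ)..T, L u u v v U U t)
      + kernelForm Pf1 (fun x => u x T) (fun x => u x T)
      + kernelForm Pf2 (fun x => v x T) (fun x => v x T)),
    (1/2) * ((∫ t in (0:ℝ)..T, L du du dv dv dU dU t)
      + kernelForm Pf1 (fun x => du x T) (fun x => du x T)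
      + kernelForm Pf2 (fun x => dv x T) (fun x => dv x T)), fun e => ?_⟩
  have hrun : (∫ t in (0:ℝ)..T,
      (kernelForm Q1 (fun x => u x t + e * du x t) (fun x => u x t + e * du x t)
        + kernelForm Q2 (fun x => v x t + e * dv x t) (fun x => v x t + e * dv x t)
        + R * (U t + e * dU t) ^ 2))
      = (∫ t in (0:ℝ)..T, L u u v v U U t) + (2 * e) * (∫ t in (0:ℝ)..T, L du u dv v U dU t)
        + e ^ 2 * ∫ t in (0:ℝ)..T, L du du dv dv dU dU t := by
    rw [← intervalIntegral.integral_const_mul, ← intervalIntegral.integral_const_mul,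
      ← intervalIntegral.integral_add h0 (h1.const_mul _),
      ← intervalIntegral.integral_add (h0.add (h1.const_mul _)) (h2.const_mul _)]
    refine integral_congr fun t ht => ?_
    rw [uIcc_of_le hT] at ht
    simp only [L, kernelForm_add_smul_self hQ1 hQ1sym (continuousOn_slice_left hu ht)
        (continuousOn_slice_left hdu ht),
      kernelForm_add_smul_self hQ2 hQ2sym (continuousOn_slice_left hv ht)
        (continuousOn_slice_left hdv ht)]
    ring
  have hfin1 := kernelForm_add_smul_self hPf1 hPf1sym (continuousOn_slice_left hu hTmem)
    (continuousOn_slice_left hdu hTmem) e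
  have hfin2 := kernelForm_add_smul_self hPf2 hPf2sym (continuousOn_slice_left hv hTmem)
    (continuousOn_slice_left hdv hTmem) e
  change (1/2) * (∫ t in (0:ℝ)..T,
      (kernelForm Q1 (fun x => u x t + e * du x t) (fun x => u x t + e * du x t)
        + kernelForm Q2 (fun x => v x t + e * dv x t) (fun x => v x t + e * dv x t)
        + R * (U t + e * dU t) ^ 2))
    + (1/2) * kernelForm Pf1 (fun x => u x T + e * du x T) (fun x => u x T + e * du x T)
    + (1/2) * kernelForm Pf2 (fun x => v x T + e * dv x T) (fun x => v x T + e * dv x T) = _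
  rw [hrun, hfin1, hfin2]
  ring

/-- The duality identity between an admissible variation and a solution of the adjoint
equations with sources `A` and `B`. -/
lemma Admissible.duality {ε1 ε2 q T : ℝ} (hε2 : ε2 ≠ 0) (hT : 0 ≤ T) {c1 c2 : ℝ → ℝ}
    {du dv : ℝ → ℝ → ℝ} {dU : ℝ → ℝ} (hadm : Admissible ε1 ε2 q T c1 c2 du dv dU)
    {lam1 lam1x lam1t lam2 lam2x lam2t A B : ℝ → ℝ → ℝ}
    (hlam1 : C1On2 T lam1 lam1x lam1t) (hlam2 : C1On2 T lam2 lam2x lam2t)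
    (hA : ContinuousOn (Function.uncurry A) (Icc (0:ℝ) 1 ×ˢ Icc (0:ℝ) T))
    (hB : ContinuousOn (Function.uncurry B) (Icc (0:ℝ) 1 ×ˢ Icc (0:ℝ) T))
    (hpde : ∀ x ∈ Icc (0:ℝ) 1, ∀ t ∈ Icc (0:ℝ) T,
      -lam1t x t = ε1 * lam1x x t + c2 x * lam2 x t + A x t ∧
      -lam2t x t = -ε2 * lam2x x t + c1 x * lam1 x t + B x t)
    (hbc : ∀ t ∈ Icc (0:ℝ) T, lam1 1 t = 0 ∧ lam2 0 t = q * (ε1 / ε2) * lam1 0 t) :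
    (∫ x in (0:ℝ)..1, du x T * lam1 x T) + (∫ x in (0:ℝ)..1, dv x T * lam2 x T)
      = ∫ t in (0:ℝ)..T, (ε2 * (lam2 1 t * dU t)
        - ((∫ x in (0:ℝ)..1, du x t * A x t) + ∫ x in (0:ℝ)..1, dv x t * B x t)) := by
  obtain ⟨dux, dut, dvx, dvt, ⟨hdu', hdu, hdux, hdut⟩, ⟨hdv', hdv, hdvx, hdvt⟩, -, hdyn, hdbc,
    hinit⟩ := hadm
  obtain ⟨hlam1', hlam1, hlam1x, hlam1t⟩ := hlam1
  obtain ⟨hlam2', hlam2, hlam2x, hlam2t⟩ := hlam2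
  have hTmem : T ∈ Icc (0:ℝ) T := right_mem_Icc.2 hT
  let G (x t : ℝ) : ℝ := (dut x t * lam1 x t + du x t * lam1t x t)
    + (dvt x t * lam2 x t + dv x t * lam2t x t)
  have hG : ContinuousOn (Function.uncurry G) (Icc (0:ℝ) 1 ×ˢ Icc (0:ℝ) T) :=
    ((hdut.mul hlam1).add (hdu.mul hlam1t)).add ((hdvt.mul hlam2).add (hdv.mul hlam2t))
  let H (x t : ℝ) : ℝ := -ε1 * (dux x t * lam1 x t + du x t * lam1x x t)
    + ε2 * (dvx x t * lam2 x t + dv x t * lam2x x t)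
  have hH : ContinuousOn (Function.uncurry H) (Icc (0:ℝ) 1 ×ˢ Icc (0:ℝ) T) :=
    (((hdux.mul hlam1).add (hdu.mul hlam1x)).const_mul _).add
      (((hdvx.mul hlam2).add (hdv.mul hlam2x)).const_mul _)
  have hGt : ∀ x ∈ Icc (0:ℝ) 1, ∫ t in (0:ℝ)..T, G x t
      = du x T * lam1 x T + dv x T * lam2 x T := by
    intro x hx
    rw [integral_eq_sub_of_hasDerivWithinAt_Icc
      (f := fun t => du x t * lam1 x t + dv x t * lam2 x t) hT
      (fun t ht => ((hdu' x hx t ht).2.mul (hlam1' x hx t ht).2).add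
        ((hdv' x hx t ht).2.mul (hlam2' x hx t ht).2))
      (continuousOn_slice_right hG hx)]
    simp [(hinit x hx).1, (hinit x hx).2]
  have hHx : ∀ t ∈ Icc (0:ℝ) T, ∫ x in (0:ℝ)..1, H x t = ε2 * (lam2 1 t * dU t) := by
    intro t ht
    rw [integral_eq_sub_of_hasDerivWithinAt_Icc
      (f := fun x => -ε1 * (du x t * lam1 x t) + ε2 * (dv x t * lam2 x t)) zero_le_one
      (fun x hx => (((hdu' x hx t ht).1.mul (hlam1' x hx t ht).1).const_mul (-ε1)).add
        (((hdv' x hx t ht).1.mul (hlam2' x hx t ht).1).const_mul ε2))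
      (continuousOn_slice_left hH ht)]
    simp only [(hbc t ht).1, (hbc t ht).2, (hdbc t ht).1, (hdbc t ht).2]
    field_simp
    ring
  have hGx : ∀ t ∈ Icc (0:ℝ) T, ∫ x in (0:ℝ)..1, G x t = ε2 * (lam2 1 t * dU t)
      - ((∫ x in (0:ℝ)..1, du x t * A x t) + ∫ x in (0:ℝ)..1, dv x t * B x t) := by
    intro t ht
    have hiA := ((continuousOn_slice_left hdu ht).fun_mul
      (continuousOn_slice_left hA ht)).intervalIntegrable_of_Icc
      (μ := volume) zero_le_one
    have hiB := ((continuousOn_slice_left hdv ht).fun_mul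
      (continuousOn_slice_left hB ht)).intervalIntegrable_of_Icc
      (μ := volume) zero_le_one
    have hiH := (continuousOn_slice_left hH ht).intervalIntegrable_of_Icc
      (μ := volume) zero_le_one
    rw [← hHx t ht, ← intervalIntegral.integral_add hiA hiB,
      ← intervalIntegral.integral_sub hiH (hiA.add hiB)]
    refine integral_congr fun x hx => ?_
    rw [uIcc_of_le zero_le_one] at hx
    simp only [G, H]
    linear_combination lam1 x t * (hdyn x hx t ht).1 + lam2 x t * (hdyn x hx t ht).2
      - du x t * (hpde x hx t ht).1 - dv x t * (hpde x hx t ht).2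
  have hswap : ∫ x in (0:ℝ)..1, ∫ t in (0:ℝ)..T, G x t
      = ∫ t in (0:ℝ)..T, ∫ x in (0:ℝ)..1, G x t := by
    refine intervalIntegral_intervalIntegral_swap ?_
    rw [uIoc_of_le zero_le_one, uIoc_of_le hT]
    exact (hG.integrableOn_compact (isCompact_Icc.prod isCompact_Icc)).mono_set
      (prod_mono Ioc_subset_Icc_self Ioc_subset_Icc_self)
  rw [← intervalIntegral.integral_add
    (((continuousOn_slice_left hdu hTmem).fun_mul
      (continuousOn_slice_left hlam1 hTmem)).intervalIntegrable_of_Icc zero_le_one)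
    (((continuousOn_slice_left hdv hTmem).fun_mul
      (continuousOn_slice_left hlam2 hTmem)).intervalIntegrable_of_Icc zero_le_one)]
  calc ∫ x in (0:ℝ)..1, (du x T * lam1 x T + dv x T * lam2 x T)
      = ∫ x in (0:ℝ)..1, ∫ t in (0:ℝ)..T, G x t :=
        integral_congr fun x hx => (hGt x (by rwa [uIcc_of_le zero_le_one] at hx)).symm
    _ = ∫ t in (0:ℝ)..T, ∫ x in (0:ℝ)..1, G x t := hswap
    _ = _ := integral_congr fun t ht => hGx t (by rwa [uIcc_of_le hT] at ht)

/-- First-order necessary conditions, sufficiency direction of the stationarity claim: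
if `(u*, v*, U*)` solves the state system, `(λ₁, λ₂)` solves the associated adjoint
system, and `U*(t) = -(ε₂/R) λ₂(1,t)` on `[0,T]`, then for every admissible variation
`(δu, δv, δU)` the map `ε ↦ J(u* + ε δu, v* + ε δv, U* + ε δU)` is differentiable at
`ε = 0` with derivative `0`. -/
theorem first_order_stationarity
    (ε1 ε2 q R T : ℝ) (hε1 : 0 < ε1) (hε2 : 0 < ε2) (hq : q ≠ 0) (hR : 0 < R) (hT : 0 < T)
    (c1 c2 : ℝ → ℝ)
    (hc1 : ContinuousOn c1 (Icc (0:ℝ) 1)) (hc2 : ContinuousOn c2 (Icc (0:ℝ) 1))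
    (Q1 Q2 Pf1 Pf2 : ℝ → ℝ → ℝ)
    (hQ1 : ContinuousOn (Function.uncurry Q1) (Icc (0:ℝ) 1 ×ˢ Icc (0:ℝ) 1))
    (hQ2 : ContinuousOn (Function.uncurry Q2) (Icc (0:ℝ) 1 ×ˢ Icc (0:ℝ) 1))
    (hPf1 : ContinuousOn (Function.uncurry Pf1) (Icc (0:ℝ) 1 ×ˢ Icc (0:ℝ) 1))
    (hPf2 : ContinuousOn (Function.uncurry Pf2) (Icc (0:ℝ) 1 ×ˢ Icc (0:ℝ) 1))
    (hQ1sym : ∀ x ∈ Icc (0:ℝ) 1, ∀ y ∈ Icc (0:ℝ) 1, Q1 x y = Q1 y x)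
    (hQ2sym : ∀ x ∈ Icc (0:ℝ) 1, ∀ y ∈ Icc (0:ℝ) 1, Q2 x y = Q2 y x)
    (hPf1sym : ∀ x ∈ Icc (0:ℝ) 1, ∀ y ∈ Icc (0:ℝ) 1, Pf1 x y = Pf1 y x)
    (hPf2sym : ∀ x ∈ Icc (0:ℝ) 1, ∀ y ∈ Icc (0:ℝ) 1, Pf2 x y = Pf2 y x)
    (u v lam1 lam2 : ℝ → ℝ → ℝ) (U : ℝ → ℝ)
    (hstate : SolvesState ε1 ε2 q T c1 c2 u v U)
    (hadjoint : SolvesAdjoint ε1 ε2 q T c1 c2 Q1 Q2 Pf1 Pf2 u v lam1 lam2)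
    (hU : ∀ t ∈ Icc (0:ℝ) T, U t = -(ε2 / R) * lam2 1 t) :
    ∀ du dv : ℝ → ℝ → ℝ, ∀ dU : ℝ → ℝ, Admissible ε1 ε2 q T c1 c2 du dv dU →
      HasDerivAt (fun e : ℝ => cost T R Q1 Q2 Pf1 Pf2
        (fun x t => u x t + e * du x t) (fun x t => v x t + e * dv x t)
        (fun t => U t + e * dU t)) 0 0 := by
  intro du dv dU hadm
  obtain ⟨ux, ut, vx, vt, ⟨-, hu, -, -⟩, ⟨-, hv, -, -⟩, hUc, -, -⟩ := hstate
  obtain ⟨lam1x, lam1t, lam2x, lam2t, hlam1, hlam2, hpde, hbc, hterm⟩ := hadjoint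
  have hdual := hadm.duality hε2.ne' hT.le hlam1 hlam2 (continuousOn_kernel_apply hQ1 hu)
    (continuousOn_kernel_apply hQ2 hv) hpde hbc
  obtain ⟨-, -, -, -, ⟨-, hdu, -, -⟩, ⟨-, hdv, -, -⟩, hdU, -, -, -⟩ := hadm
  obtain ⟨a, b, hab⟩ := exists_cost_add_smul_eq (R := R) hT.le hQ1 hQ2 hPf1 hPf2 hQ1sym hQ2sym
    hPf1sym hPf2sym hu hv hUc hdu hdv hdU
  have hfin1 : kernelForm Pf1 (fun x => du x T) (fun x => u x T)
      = ∫ x in (0:ℝ)..1, du x T * lam1 x T := integral_congr fun x hx => by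
    rw [uIcc_of_le zero_le_one] at hx
    simp only [(hterm x hx).1]
  have hfin2 : kernelForm Pf2 (fun x => dv x T) (fun x => v x T)
      = ∫ x in (0:ℝ)..1, dv x T * lam2 x T := integral_congr fun x hx => by
    rw [uIcc_of_le zero_le_one] at hx
    simp only [(hterm x hx).2]
  have hrun : (∫ t in (0:ℝ)..T, (ε2 * (lam2 1 t * dU t)
        - ((∫ x in (0:ℝ)..1, du x t * ∫ y in (0:ℝ)..1, Q1 x y * u y t)
          + ∫ x in (0:ℝ)..1, dv x t * ∫ y in (0:ℝ)..1, Q2 x y * v y t)))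
      = -∫ t in (0:ℝ)..T, (kernelForm Q1 (fun x => du x t) (fun x => u x t)
          + kernelForm Q2 (fun x => dv x t) (fun x => v x t) + R * (U t * dU t)) := by
    rw [← intervalIntegral.integral_neg]
    refine integral_congr fun t ht => ?_
    rw [uIcc_of_le hT.le] at ht
    simp only [kernelForm, hU t ht]
    field_simp
    ring
  have hvar : (∫ t in (0:ℝ)..T, (kernelForm Q1 (fun x => du x t) (fun x => u x t)
          + kernelForm Q2 (fun x => dv x t) (fun x => v x t) + R * (U t * dU t)))
        + kernelForm Pf1 (fun x => du x T) (fun x => u x T)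
        + kernelForm Pf2 (fun x => dv x T) (fun x => v x T) = 0 := by
    rw [hfin1, hfin2]
    linear_combination hdual + hrun
  simp only [hab, hvar, mul_zero, add_zero]
  simpa using ((hasDerivAt_pow 2 (0:ℝ)).mul_const b).const_add a
end

section
/- Let ε1, ε2 > 0, q ≠ 0, R > 0, T > 0, let c1, c2 ∈ ℝ be constants, and let Q1, Q2, Pf1, Pf2 : [0,1]² → ℝ be continuous symmetric kernels. Suppose P1, P2 ∈ C¹([0,1]²×[0,T]) satisfy the differential algebraic Riccati system: -∂ₜP2(x,y,t) = -(ε2²/R) P2(x,1,t) P2(1,y,t) - ε2 ∂_y P2(x,y,t) - ε2 ∂ₓP2(x,y,t) + Q2(x,y), -∂ₜP1(x,y,t) = ε1 ∂_y P1(x,y,t) + ε1 ∂ₓP1(x,y,t) + Q1(x,y), c1 P1(x,y,t) + c2 P2(x,y,t) = 0, with boundary conditions P2(x,0,t) = 0, P1(x,1,t) = 0, P1(x,0,t) = 0, P1(1,y,t) = 0, P1(0,y,t) = 0, P2(0,y,t) = 0, and final conditions P1(x,y,T) = Pf1(x,y), P2(x,y,T) = Pf2(x,y). Suppose u*, v*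 ∈ C¹([0,1]×[0,T]) solve the state system with control U*(t) = -(ε2/R) ∫₀¹ P2(1,y,t) v*(y,t) dy. Then the functions λ1(x,t) := ∫₀¹ P1(x,y,t) u*(y,t) dy and λ2(x,t) := ∫₀¹ P2(x,y,t) v*(y,t) dy solve the adjoint system associated with (u*, v*) (with c1(x) ≡ c1, c2(x) ≡ c2), and U*(t) = -(ε2/R) λ2(1,t) for all t ∈ [0,T]. -/
open MeasureTheory intervalIntegral Set

/-- `P : ℝ → ℝ → ℝ → ℝ`, `(x, y, t) ↦ P x y t`, is C¹ on `[0,1] × [0,1] × [0,T]`,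
with partial derivatives `Px`, `Py`, `Pt` in the first, second and third arguments,
all continuous on the box. -/
def C1On3 (T : ℝ) (P Px Py Pt : ℝ → ℝ → ℝ → ℝ) : Prop :=
  (∀ x ∈ Icc (0:ℝ) 1, ∀ y ∈ Icc (0:ℝ) 1, ∀ t ∈ Icc (0:ℝ) T,
      HasDerivWithinAt (fun s => P s y t) (Px x y t) (Icc (0:ℝ) 1) x ∧
      HasDerivWithinAt (fun s => P x s t) (Py x y t) (Icc (0:ℝ) 1) y ∧
      HasDerivWithinAt (fun s => P x y s) (Pt x y t) (Icc (0:ℝ) T) t) ∧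
  ContinuousOn (fun p : ℝ × ℝ × ℝ => P p.1 p.2.1 p.2.2)
    (Icc (0:ℝ) 1 ×ˢ Icc (0:ℝ) 1 ×ˢ Icc (0:ℝ) T) ∧
  ContinuousOn (fun p : ℝ × ℝ × ℝ => Px p.1 p.2.1 p.2.2)
    (Icc (0:ℝ) 1 ×ˢ Icc (0:ℝ) 1 ×ˢ Icc (0:ℝ) T) ∧
  ContinuousOn (fun p : ℝ × ℝ × ℝ => Py p.1 p.2.1 p.2.2)
    (Icc (0:ℝ) 1 ×ˢ Icc (0:ℝ) 1 ×ˢ Icc (0:ℝ) T) ∧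
  ContinuousOn (fun p : ℝ × ℝ × ℝ => Pt p.1 p.2.1 p.2.2)
    (Icc (0:ℝ) 1 ×ˢ Icc (0:ℝ) 1 ×ˢ Icc (0:ℝ) T)

/-- Integrating out one variable of a function continuous on `s × [a, b]` leaves a function
continuous on `s`. -/
theorem continuousOn_intervalIntegral_of_prod {X : Type*} [TopologicalSpace X]
    [FirstCountableTopology X] {s : Set X} {a b : ℝ} (hab : a ≤ b) {F : X → ℝ → ℝ}
    (hF : ContinuousOn (Function.uncurry F) (s ×ˢ Icc a b)) :
    ContinuousOn (fun x => ∫ y in a..b, F x y) s := by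
  have hG : Continuous (Function.uncurry fun (x : s) (y : ℝ) => F x (projIcc a b hab y)) :=
    hF.comp_continuous (f := fun p : s × ℝ => ((p.1 : X), (projIcc a b hab p.2 : ℝ)))
      (by fun_prop) fun p => ⟨p.1.2, (projIcc a b hab p.2).2⟩
  rw [continuousOn_iff_continuous_domRestrict]
  refine (continuous_parametric_intervalIntegral_of_continuous' (μ := volume) hG a b).congr
    fun x => integral_congr fun y hy => ?_
  rw [uIcc_of_le hab] at hy
  simp [projIcc_of_mem hab hy]

open scoped Topology in
/-- Differentiation under the integral sign, one-sided at the endpoints of `[c, d]`. -/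
theorem hasDerivWithinAt_intervalIntegral_of_prod {a b c d : ℝ} (hab : a ≤ b)
    {F F' : ℝ → ℝ → ℝ}
    (hF : ContinuousOn (Function.uncurry F) (Icc c d ×ˢ Icc a b))
    (hF' : ContinuousOn (Function.uncurry F') (Icc c d ×ˢ Icc a b))
    (hderiv : ∀ x ∈ Icc c d, ∀ y ∈ Icc a b,
      HasDerivWithinAt (fun s => F s y) (F' x y) (Icc c d) x)
    {x : ℝ} (hx : x ∈ Icc c d) :
    HasDerivWithinAt (fun s => ∫ y in a..b, F s y) (∫ y in a..b, F' x y) (Icc c d) x := by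
  obtain ⟨C, hC⟩ := (isCompact_Icc.prod isCompact_Icc).exists_bound_of_continuousOn hF'
  have hslice : ∀ s ∈ Icc c d, ContinuousOn (F s) (Icc a b) := fun s hs =>
    hF.comp (f := fun y => (s, y)) (by fun_prop) fun y hy => ⟨hs, hy⟩
  have hint : ∀ s ∈ Icc c d, IntervalIntegrable (F s) volume a b := fun s hs =>
    (hslice s hs).intervalIntegrable_of_Icc hab
  have hsub : uIoc a b ⊆ Icc a b := uIoc_of_le hab ▸ Ioc_subset_Icc_self
  have hnear : ∀ᶠ s in 𝓝[Icc c d \ {x}] x, s ∈ Icc c d \ {x} := self_mem_nhdsWithin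
  rw [hasDerivWithinAt_iff_tendsto_slope]
  have hlim : Filter.Tendsto (fun s => ∫ y in a..b, slope (fun r => F r y) x s)
      (𝓝[Icc c d \ {x}] x) (𝓝 (∫ y in a..b, F' x y)) := by
    refine tendsto_integral_filter_of_dominated_convergence (fun _ => C) ?_ ?_ (by simp) ?_
    · filter_upwards [hnear] with s hs
      have := ((hint s hs.1).sub (hint x hx)).const_mul (s - x)⁻¹
      rw [uIoc_of_le hab]
      exact (this.1.congr_fun (fun y _ => by rw [slope_def_field]; ring)
        measurableSet_Ioc).aestronglyMeasurable
    · filter_upwards [hnear] with s hs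
      refine Filter.Eventually.of_forall fun y hy => ?_
      have hpos : 0 < ‖s - x‖ := norm_pos_iff.2 (sub_ne_zero.2 hs.2)
      have := (convex_Icc c d).norm_image_sub_le_of_norm_hasDerivWithin_le
        (fun r hr => hderiv r hr y (hsub hy)) (fun r hr => hC (r, y) ⟨hr, hsub hy⟩) hx hs.1
      rw [slope_def_field, norm_div]
      exact (div_le_iff₀ hpos).2 this
    · exact Filter.Eventually.of_forall fun y hy =>
        hasDerivWithinAt_iff_tendsto_slope.1 (hderiv x hx y (hsub hy))
  refine hlim.congr' ?_
  filter_upwards [hnear] with s hs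
  simp only [slope_def_field]
  rw [intervalIntegral.integral_div, integral_sub (hint s hs.1) (hint x hx)]

theorem C1On2.continuousOn_slice {T t : ℝ} {w wx wt : ℝ → ℝ → ℝ} (hw : C1On2 T w wx wt)
    (ht : t ∈ Icc (0:ℝ) T) :
    ContinuousOn (fun y => w y t) (Icc 0 1) ∧ ContinuousOn (fun y => wx y t) (Icc 0 1) ∧
      ContinuousOn (fun y => wt y t) (Icc 0 1) := by
  obtain ⟨-, h, hx, ht'⟩ := hw
  have hmaps : MapsTo (fun y : ℝ => (y, t)) (Icc 0 1) (Icc (0:ℝ) 1 ×ˢ Icc (0:ℝ) T) :=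
    fun y hy => ⟨hy, ht⟩
  have hc : ContinuousOn (fun y : ℝ => (y, t)) (Icc 0 1) := by fun_prop
  exact ⟨h.comp hc hmaps, hx.comp hc hmaps, ht'.comp hc hmaps⟩

theorem C1On3.continuousOn_slice {T x t : ℝ} {P Px Py Pt : ℝ → ℝ → ℝ → ℝ}
    (hP : C1On3 T P Px Py Pt) (hx : x ∈ Icc (0:ℝ) 1) (ht : t ∈ Icc (0:ℝ) T) :
    ContinuousOn (fun y => P x y t) (Icc 0 1) ∧ ContinuousOn (fun y => Px x y t) (Icc 0 1) ∧
      ContinuousOn (fun y => Py x y t) (Icc 0 1) ∧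
      ContinuousOn (fun y => Pt x y t) (Icc 0 1) := by
  obtain ⟨-, h, hx', hy', ht'⟩ := hP
  have hmaps : MapsTo (fun y : ℝ => (x, y, t)) (Icc 0 1)
      (Icc (0:ℝ) 1 ×ˢ Icc (0:ℝ) 1 ×ˢ Icc (0:ℝ) T) := fun y hy => ⟨hx, hy, ht⟩
  have hc : ContinuousOn (fun y : ℝ => (x, y, t)) (Icc 0 1) := by fun_prop
  exact ⟨h.comp hc hmaps, hx'.comp hc hmaps, hy'.comp hc hmaps, ht'.comp hc hmaps⟩

/-- Applying a C¹ time-dependent kernel to a C¹ function gives a C¹ function, with the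
derivatives computed under the integral sign. -/
theorem C1On3.c1On2_integral {T : ℝ} {P Px Py Pt : ℝ → ℝ → ℝ → ℝ} {w wx wt : ℝ → ℝ → ℝ}
    (hP : C1On3 T P Px Py Pt) (hw : C1On2 T w wx wt) :
    C1On2 T (fun x t => ∫ y in (0:ℝ)..1, P x y t * w y t)
      (fun x t => ∫ y in (0:ℝ)..1, Px x y t * w y t)
      (fun x t => ∫ y in (0:ℝ)..1, (Pt x y t * w y t + P x y t * wt y t)) := by
  obtain ⟨hPd, hPc, hPxc, -, hPtc⟩ := hP
  obtain ⟨hwd, hwc, -, hwtc⟩ := hw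
  have hbox : MapsTo (fun p : (ℝ × ℝ) × ℝ => (p.1.1, p.2, p.1.2))
      ((Icc (0:ℝ) 1 ×ˢ Icc (0:ℝ) T) ×ˢ Icc (0:ℝ) 1)
      (Icc (0:ℝ) 1 ×ˢ Icc (0:ℝ) 1 ×ˢ Icc (0:ℝ) T) := fun p hp => ⟨hp.1.1, hp.2, hp.1.2⟩
  have hrect : MapsTo (fun p : (ℝ × ℝ) × ℝ => (p.2, p.1.2))
      ((Icc (0:ℝ) 1 ×ˢ Icc (0:ℝ) T) ×ˢ Icc (0:ℝ) 1)
      (Icc (0:ℝ) 1 ×ˢ Icc (0:ℝ) T) := fun p hp => ⟨hp.2, hp.1.2⟩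
  have hc3 : ContinuousOn (fun p : (ℝ × ℝ) × ℝ => (p.1.1, p.2, p.1.2))
      ((Icc (0:ℝ) 1 ×ˢ Icc (0:ℝ) T) ×ˢ Icc (0:ℝ) 1) := by fun_prop
  have hc2 : ContinuousOn (fun p : (ℝ × ℝ) × ℝ => (p.2, p.1.2))
      ((Icc (0:ℝ) 1 ×ˢ Icc (0:ℝ) T) ×ˢ Icc (0:ℝ) 1) := by fun_prop
  have hPw := (hPc.comp hc3 hbox).mul (hwc.comp hc2 hrect)
  have hPxw := (hPxc.comp hc3 hbox).mul (hwc.comp hc2 hrect)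
  have hPtw := ((hPtc.comp hc3 hbox).mul (hwc.comp hc2 hrect)).add
    ((hPc.comp hc3 hbox).mul (hwtc.comp hc2 hrect))
  refine ⟨fun x hx t ht => ⟨?_, ?_⟩, ?_, ?_, ?_⟩
  · have hmaps : MapsTo (fun p : ℝ × ℝ => ((p.1, t), p.2)) (Icc (0:ℝ) 1 ×ˢ Icc (0:ℝ) 1)
        ((Icc (0:ℝ) 1 ×ˢ Icc (0:ℝ) T) ×ˢ Icc (0:ℝ) 1) := fun p hp => ⟨⟨hp.1, ht⟩, hp.2⟩
    have hc : ContinuousOn (fun p : ℝ × ℝ => ((p.1, t), p.2)) (Icc (0:ℝ) 1 ×ˢ Icc (0:ℝ) 1) := by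
      fun_prop
    exact hasDerivWithinAt_intervalIntegral_of_prod (F := fun s y => P s y t * w y t)
      (F' := fun s y => Px s y t * w y t) zero_le_one (hPw.comp hc hmaps) (hPxw.comp hc hmaps)
      (fun s hs y hy => (hPd s hs y hy t ht).1.mul_const _) hx
  · have hmaps : MapsTo (fun p : ℝ × ℝ => ((x, p.1), p.2)) (Icc (0:ℝ) T ×ˢ Icc (0:ℝ) 1)
        ((Icc (0:ℝ) 1 ×ˢ Icc (0:ℝ) T) ×ˢ Icc (0:ℝ) 1) := fun p hp => ⟨⟨hx, hp.1⟩, hp.2⟩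
    have hc : ContinuousOn (fun p : ℝ × ℝ => ((x, p.1), p.2)) (Icc (0:ℝ) T ×ˢ Icc (0:ℝ) 1) := by
      fun_prop
    exact hasDerivWithinAt_intervalIntegral_of_prod (F := fun s y => P x y s * w y s)
      (F' := fun s y => Pt x y s * w y s + P x y s * wt y s) zero_le_one
      (hPw.comp hc hmaps) (hPtw.comp hc hmaps)
      (fun s hs y hy => (hPd x hx y hy s hs).2.2.mul (hwd y hy s hs).2) ht
  · exact continuousOn_intervalIntegral_of_prod
      (F := fun (p : ℝ × ℝ) y => P p.1 y p.2 * w y p.2) zero_le_one hPw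
  · exact continuousOn_intervalIntegral_of_prod
      (F := fun (p : ℝ × ℝ) y => Px p.1 y p.2 * w y p.2) zero_le_one hPxw
  · exact continuousOn_intervalIntegral_of_prod
      (F := fun (p : ℝ × ℝ) y => Pt p.1 y p.2 * w y p.2 + P p.1 y p.2 * wt y p.2)
      zero_le_one hPtw

/-- Integration by parts in the space variable of a kernel. -/
theorem C1On3.integral_by_parts {T x t : ℝ} {P Px Py Pt : ℝ → ℝ → ℝ → ℝ}
    {w wx wt : ℝ → ℝ → ℝ} (hP : C1On3 T P Px Py Pt) (hw : C1On2 T w wx wt)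
    (hx : x ∈ Icc (0:ℝ) 1) (ht : t ∈ Icc (0:ℝ) T) :
    ∫ y in (0:ℝ)..1, (Py x y t * w y t + P x y t * wx y t) =
      P x 1 t * w 1 t - P x 0 t * w 0 t := by
  refine integral_deriv_mul_eq_sub_of_hasDerivWithinAt (u := fun y => P x y t)
    (v := fun y => w y t) ?_ ?_
    ((hP.continuousOn_slice hx ht).2.2.1.intervalIntegrable_of_Icc zero_le_one)
    ((hw.continuousOn_slice ht).2.1.intervalIntegrable_of_Icc zero_le_one)
  · rw [uIcc_of_le zero_le_one]
    exact fun y hy => (hP.1 x hx y hy t ht).2.1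
  · rw [uIcc_of_le zero_le_one]
    exact fun y hy => (hw.1 y hy t ht).1

/-- State-feedback result: if `P₁, P₂` solve the differential algebraic Riccati system
with its boundary and final conditions, and `(u*, v*)` solves the state system with the
feedback control `U*(t) = -(ε₂/R) ∫₀¹ P₂(1,y,t) v*(y,t) dy`, then
`λ₁(x,t) := ∫₀¹ P₁(x,y,t) u*(y,t) dy` and `λ₂(x,t) := ∫₀¹ P₂(x,y,t) v*(y,t) dy`
solve the adjoint system associated with `(u*, v*)`, and `U*(t) = -(ε₂/R) λ₂(1,t)`. -/
theorem state_feedback_riccati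
    (ε1 ε2 q R T c1 c2 : ℝ)
    (hε1 : 0 < ε1) (hε2 : 0 < ε2) (hq : q ≠ 0) (hR : 0 < R) (hT : 0 < T)
    (Q1 Q2 Pf1 Pf2 : ℝ → ℝ → ℝ)
    (hQ1 : ContinuousOn (Function.uncurry Q1) (Icc (0:ℝ) 1 ×ˢ Icc (0:ℝ) 1))
    (hQ2 : ContinuousOn (Function.uncurry Q2) (Icc (0:ℝ) 1 ×ˢ Icc (0:ℝ) 1))
    (hPf1 : ContinuousOn (Function.uncurry Pf1) (Icc (0:ℝ) 1 ×ˢ Icc (0:ℝ) 1))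
    (hPf2 : ContinuousOn (Function.uncurry Pf2) (Icc (0:ℝ) 1 ×ˢ Icc (0:ℝ) 1))
    (hQ1sym : ∀ x ∈ Icc (0:ℝ) 1, ∀ y ∈ Icc (0:ℝ) 1, Q1 x y = Q1 y x)
    (hQ2sym : ∀ x ∈ Icc (0:ℝ) 1, ∀ y ∈ Icc (0:ℝ) 1, Q2 x y = Q2 y x)
    (hPf1sym : ∀ x ∈ Icc (0:ℝ) 1, ∀ y ∈ Icc (0:ℝ) 1, Pf1 x y = Pf1 y x)
    (hPf2sym : ∀ x ∈ Icc (0:ℝ) 1, ∀ y ∈ Icc (0:ℝ) 1, Pf2 x y = Pf2 y x)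
    (P1 P1x P1y P1t P2 P2x P2y P2t : ℝ → ℝ → ℝ → ℝ)
    (hP1 : C1On3 T P1 P1x P1y P1t) (hP2 : C1On3 T P2 P2x P2y P2t)
    (hric2 : ∀ x ∈ Icc (0:ℝ) 1, ∀ y ∈ Icc (0:ℝ) 1, ∀ t ∈ Icc (0:ℝ) T,
      -P2t x y t = -(ε2 ^ 2 / R) * P2 x 1 t * P2 1 y t
        - ε2 * P2y x y t - ε2 * P2x x y t + Q2 x y)
    (hric1 : ∀ x ∈ Icc (0:ℝ) 1, ∀ y ∈ Icc (0:ℝ) 1, ∀ t ∈ Icc (0:ℝ) T,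
      -P1t x y t = ε1 * P1y x y t + ε1 * P1x x y t + Q1 x y)
    (halg : ∀ x ∈ Icc (0:ℝ) 1, ∀ y ∈ Icc (0:ℝ) 1, ∀ t ∈ Icc (0:ℝ) T,
      c1 * P1 x y t + c2 * P2 x y t = 0)
    (hbcP2y0 : ∀ x ∈ Icc (0:ℝ) 1, ∀ t ∈ Icc (0:ℝ) T, P2 x 0 t = 0)
    (hbcP1y1 : ∀ x ∈ Icc (0:ℝ) 1, ∀ t ∈ Icc (0:ℝ) T, P1 x 1 t = 0)
    (hbcP1y0 : ∀ x ∈ Icc (0:ℝ) 1, ∀ t ∈ Icc (0:ℝ) T, P1 x 0 t = 0)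
    (hbcP1x1 : ∀ y ∈ Icc (0:ℝ) 1, ∀ t ∈ Icc (0:ℝ) T, P1 1 y t = 0)
    (hbcP1x0 : ∀ y ∈ Icc (0:ℝ) 1, ∀ t ∈ Icc (0:ℝ) T, P1 0 y t = 0)
    (hbcP2x0 : ∀ y ∈ Icc (0:ℝ) 1, ∀ t ∈ Icc (0:ℝ) T, P2 0 y t = 0)
    (hfin1 : ∀ x ∈ Icc (0:ℝ) 1, ∀ y ∈ Icc (0:ℝ) 1, P1 x y T = Pf1 x y)
    (hfin2 : ∀ x ∈ Icc (0:ℝ) 1, ∀ y ∈ Icc (0:ℝ) 1, P2 x y T = Pf2 x y)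
    (u v : ℝ → ℝ → ℝ) (U : ℝ → ℝ)
    (hU : ∀ t ∈ Icc (0:ℝ) T,
      U t = -(ε2 / R) * ∫ y in (0:ℝ)..1, P2 1 y t * v y t)
    (hstate : SolvesState ε1 ε2 q T (fun _ => c1) (fun _ => c2) u v U) :
    SolvesAdjoint ε1 ε2 q T (fun _ => c1) (fun _ => c2) Q1 Q2 Pf1 Pf2 u v
        (fun x t => ∫ y in (0:ℝ)..1, P1 x y t * u y t)
        (fun x t => ∫ y in (0:ℝ)..1, P2 x y t * v y t) ∧
      ∀ t ∈ Icc (0:ℝ) T,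
        U t = -(ε2 / R) * ∫ y in (0:ℝ)..1, P2 1 y t * v y t := by
  refine ⟨?_, hU⟩
  obtain ⟨ux, ut, vx, vt, hu, hv, -, hpde, hbc⟩ := hstate
  have h1 : (1:ℝ) ∈ Icc (0:ℝ) 1 := right_mem_Icc.2 zero_le_one
  have hzero : ∀ f : ℝ → ℝ, (∀ y ∈ Icc (0:ℝ) 1, f y = 0) → ∫ y in (0:ℝ)..1, f y = 0 := by
    intro f hf
    rw [← uIcc_of_le (zero_le_one' ℝ)] at hf
    simp [integral_congr (g := fun _ => (0:ℝ)) hf]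
  have hint : ∀ f g : ℝ → ℝ, ContinuousOn f (Icc 0 1) → ContinuousOn g (Icc 0 1) →
      IntervalIntegrable (fun y => f y * g y) volume 0 1 := fun f g hf hg =>
    (hf.mul hg).intervalIntegrable_of_Icc zero_le_one
  refine ⟨_, _, _, _, hP1.c1On2_integral hu, hP2.c1On2_integral hv,
    fun x hx t ht => ?_, fun t ht => ⟨?_, ?_⟩, fun x hx => ⟨?_, ?_⟩⟩
  · obtain ⟨cu, cux, -⟩ := hu.continuousOn_slice ht
    obtain ⟨cv, cvx, -⟩ := hv.continuousOn_slice ht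
    obtain ⟨cP1, cP1x, cP1y, -⟩ := hP1.continuousOn_slice hx ht
    obtain ⟨cP2, cP2x, cP2y, -⟩ := hP2.continuousOn_slice hx ht
    have cP21 := (hP2.continuousOn_slice h1 ht).1
    have cQ1 : ContinuousOn (fun y => Q1 x y) (Icc 0 1) :=
      hQ1.comp (f := fun y => (x, y)) (by fun_prop) fun y hy => ⟨hx, hy⟩
    have cQ2 : ContinuousOn (fun y => Q2 x y) (Icc 0 1) :=
      hQ2.comp (f := fun y => (x, y)) (by fun_prop) fun y hy => ⟨hx, hy⟩
    constructor
    · have hparts := hP1.integral_by_parts hu hx ht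
      rw [hbcP1y1 x hx t ht, hbcP1y0 x hx t ht] at hparts
      have hsplit : -(∫ y in (0:ℝ)..1, (P1t x y t * u y t + P1 x y t * ut y t)) =
          ∫ y in (0:ℝ)..1, (ε1 * (P1x x y t * u y t) + c2 * (P2 x y t * v y t)
            + Q1 x y * u y t + ε1 * (P1y x y t * u y t + P1 x y t * ux y t)) := by
        rw [← intervalIntegral.integral_neg]
        refine integral_congr fun y hy => ?_
        rw [uIcc_of_le zero_le_one] at hy
        linear_combination u y t * hric1 x hx y hy t ht - P1 x y t * (hpde y hy t ht).1
          - v y t * halg x hx y hy t ht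
      have i1 := (hint _ _ cP1x cu).const_mul ε1
      have i2 := (hint _ _ cP2 cv).const_mul c2
      have i3 := hint _ _ cQ1 cu
      have i4 := ((hint _ _ cP1y cu).add (hint _ _ cP1 cux)).const_mul ε1
      rw [hsplit, integral_add ((i1.add i2).add i3) i4, integral_add (i1.add i2) i3,
        integral_add i1 i2]
      simp only [intervalIntegral.integral_const_mul]
      rw [hparts]
      ring
    · have hparts := hP2.integral_by_parts hv hx ht
      rw [hbcP2y0 x hx t ht, (hbc t ht).2, hU t ht] at hparts
      have hsplit : -(∫ y in (0:ℝ)..1, (P2t x y t * v y t + P2 x y t * vt y t)) =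
          ∫ y in (0:ℝ)..1, (-ε2 * (P2x x y t * v y t) + c1 * (P1 x y t * u y t)
            + Q2 x y * v y t + -ε2 * (P2y x y t * v y t + P2 x y t * vx y t)
            + -(ε2 ^ 2 / R) * P2 x 1 t * (P2 1 y t * v y t)) := by
        rw [← intervalIntegral.integral_neg]
        refine integral_congr fun y hy => ?_
        rw [uIcc_of_le zero_le_one] at hy
        linear_combination v y t * hric2 x hx y hy t ht - P2 x y t * (hpde y hy t ht).2
          - u y t * halg x hx y hy t ht
      have i1 := (hint _ _ cP2x cv).const_mul (-ε2)
      have i2 := (hint _ _ cP1 cu).const_mul c1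
      have i3 := hint _ _ cQ2 cv
      have i4 := ((hint _ _ cP2y cv).add (hint _ _ cP2 cvx)).const_mul (-ε2)
      have i5 := (hint _ _ cP21 cv).const_mul (-(ε2 ^ 2 / R) * P2 x 1 t)
      rw [hsplit, integral_add (((i1.add i2).add i3).add i4) i5,
        integral_add ((i1.add i2).add i3) i4, integral_add (i1.add i2) i3, integral_add i1 i2]
      simp only [intervalIntegral.integral_const_mul]
      rw [hparts]
      ring
  · exact hzero _ fun y hy => by rw [hbcP1x1 y hy t ht, zero_mul]
  · have e1 := hzero (fun y => P1 0 y t * u y t) fun y hy => by simp [hbcP1x0 y hy t ht]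
    have e2 := hzero (fun y => P2 0 y t * v y t) fun y hy => by simp [hbcP2x0 y hy t ht]
    simp only [e1, e2, mul_zero]
  · refine integral_congr fun y hy => ?_
    rw [uIcc_of_le zero_le_one] at hy
    simp only [hfin1 x hx y hy]
  · refine integral_congr fun y hy => ?_
    rw [uIcc_of_le zero_le_one] at hy
    simp only [hfin2 x hx y hy]
end

section
/- Let ε1, ε2 > 0, q ∈ ℝ, T > 0, let c1, c2 ∈ ℝ be constants, and let Q1 : [0,1]² → ℝ be continuous. Let u*, v* ∈ C¹([0,1]×[0,T]) satisfy u*_t = -ε1 u*_x + c1 v*, v*_t = ε2 v*_x + c2 u*, and u*(0,t) = q v*(0,t). Let P1, P2 ∈ C¹([0,1]²×[0,T]) satisfy: -∂ₜP1(x,y,t) = ε1 ∂_y P1(x,y,t) + ε1 ∂ₓP1(x,y,t) + Q1(x,y), c1 P1(x,y,t) + c2 P2(x,y,t) = 0, P1(x,1,t) = 0, and P1(x,0,t) = 0 for all (x,y,t). Define λ1(x,t) := ∫₀¹ P1(x,y,t) u*(y,t) dy and λ2(x,t) := ∫₀¹ P2(x,y,t) v*(y,t) dy. Then for all (x,t)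 ∈ [0,1]×[0,T]: -λ1_t(x,t) = ε1 λ1_x(x,t) + c2 λ2(x,t) + ∫₀¹ Q1(x,y) u*(y,t) dy. -/
open MeasureTheory intervalIntegral Set

/-- Differentiation under the integral sign, for a one-sided derivative relative to a compact
convex set of parameters. -/
theorem hasDerivWithinAt_intervalIntegral_of_continuousOn {S : Set ℝ} (hconv : Convex ℝ S)
    (hcomp : IsCompact S) {a b : ℝ} (hab : a ≤ b) {F F' : ℝ → ℝ → ℝ}
    (hF : ContinuousOn (Function.uncurry F) (S ×ˢ Icc a b))
    (hF' : ContinuousOn (Function.uncurry F') (S ×ˢ Icc a b))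
    (hd : ∀ s ∈ S, ∀ y ∈ Icc a b, HasDerivWithinAt (fun r => F r y) (F' s y) S s)
    {s : ℝ} (hs : s ∈ S) :
    HasDerivWithinAt (fun r => ∫ y in a..b, F r y) (∫ y in a..b, F' s y) S s := by
  obtain ⟨C, hC⟩ := (hcomp.prod isCompact_Icc).exists_bound_of_continuousOn hF'
  have hint : ∀ r ∈ S, IntervalIntegrable (F r) volume a b := fun r hr =>
    ContinuousOn.intervalIntegrable_of_Icc hab
      (hF.comp (f := fun y => (r, y)) (by fun_prop) fun y hy => ⟨hr, hy⟩)
  have hsub : uIoc a b ⊆ Icc a b := by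
    rw [uIoc_of_le hab]
    exact Ioc_subset_Icc_self
  have hslope : ∀ r ∈ S, IntervalIntegrable (fun y => slope (fun r => F r y) s r) volume a b := by
    intro r hr
    simpa only [slope_def_module, smul_eq_mul] using
      ((hint r hr).sub (hint s hs)).const_mul (r - s)⁻¹
  rw [hasDerivWithinAt_iff_tendsto_slope]
  have hmem : ∀ᶠ r in nhdsWithin s (S \ {s}), r ∈ S \ {s} := self_mem_nhdsWithin
  have key : Filter.Tendsto (fun r => ∫ y in a..b, slope (fun r => F r y) s r)
      (nhdsWithin s (S \ {s})) (nhds (∫ y in a..b, F' s y)) := by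
    refine tendsto_integral_filter_of_dominated_convergence (fun _ => C) ?_ ?_
      intervalIntegrable_const ?_
    · filter_upwards [hmem] with r hr
      exact (hslope r hr.1).def'.aestronglyMeasurable
    · filter_upwards [hmem] with r hr
      refine Filter.Eventually.of_forall fun y hy => ?_
      have hle := hconv.norm_image_sub_le_of_norm_hasDerivWithin_le (C := C)
        (fun x hx => hd x hx y (hsub hy)) (fun x hx => hC (x, y) ⟨hx, hsub hy⟩) hs hr.1
      have hpos : 0 < ‖r - s‖ := norm_pos_iff.2 (sub_ne_zero.2 hr.2)
      rw [slope_def_module, norm_smul, norm_inv, inv_mul_le_iff₀ hpos, mul_comm]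
      exact hle
    · exact Filter.Eventually.of_forall fun y hy =>
        hasDerivWithinAt_iff_tendsto_slope.1 (hd s hs y (hsub hy))
  refine key.congr' ?_
  filter_upwards [hmem] with r hr
  simp only [slope_def_module, smul_eq_mul, intervalIntegral.integral_const_mul]
  rw [intervalIntegral.integral_sub (hint r hr.1) (hint s hs)]

/-- The transformation `λ₁(x,t) = ∫₀¹ P₁(x,y,t) u*(y,t) dy`, `λ₂(x,t) = ∫₀¹ P₂(x,y,t) v*(y,t) dy`
turns a solution of the Riccati-type kernel equations for `P₁` (together with the algebraic
constraint `c₁ P₁ + c₂ P₂ = 0` and the boundary conditions `P₁(x,1,t) = P₁(x,0,t) = 0`)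
into a solution of the first adjoint equation
`-λ₁ₜ = ε₁ λ₁ₓ + c₂ λ₂ + ∫₀¹ Q₁(x,y) u*(y,t) dy`. -/
theorem first_adjoint_equation_from_riccati
    (ε1 ε2 q T c1 c2 : ℝ) (hε1 : 0 < ε1) (hε2 : 0 < ε2) (hT : 0 < T)
    (Q1 : ℝ → ℝ → ℝ)
    (hQ1 : ContinuousOn (Function.uncurry Q1) (Icc (0:ℝ) 1 ×ˢ Icc (0:ℝ) 1))
    (u ux ut v vx vt : ℝ → ℝ → ℝ)
    (hu : C1On2 T u ux ut) (hv : C1On2 T v vx vt)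
    (hpde1 : ∀ x ∈ Icc (0:ℝ) 1, ∀ t ∈ Icc (0:ℝ) T,
      ut x t = -ε1 * ux x t + c1 * v x t)
    (hpde2 : ∀ x ∈ Icc (0:ℝ) 1, ∀ t ∈ Icc (0:ℝ) T,
      vt x t = ε2 * vx x t + c2 * u x t)
    (hbc : ∀ t ∈ Icc (0:ℝ) T, u 0 t = q * v 0 t)
    (P1 P1x P1y P1t P2 P2x P2y P2t : ℝ → ℝ → ℝ → ℝ)
    (hP1 : C1On3 T P1 P1x P1y P1t) (hP2 : C1On3 T P2 P2x P2y P2t)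
    (hric1 : ∀ x ∈ Icc (0:ℝ) 1, ∀ y ∈ Icc (0:ℝ) 1, ∀ t ∈ Icc (0:ℝ) T,
      -P1t x y t = ε1 * P1y x y t + ε1 * P1x x y t + Q1 x y)
    (halg : ∀ x ∈ Icc (0:ℝ) 1, ∀ y ∈ Icc (0:ℝ) 1, ∀ t ∈ Icc (0:ℝ) T,
      c1 * P1 x y t + c2 * P2 x y t = 0)
    (hP1bc1 : ∀ x ∈ Icc (0:ℝ) 1, ∀ t ∈ Icc (0:ℝ) T, P1 x 1 t = 0)
    (hP1bc0 : ∀ x ∈ Icc (0:ℝ) 1, ∀ t ∈ Icc (0:ℝ) T, P1 x 0 t = 0) :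
    ∀ x ∈ Icc (0:ℝ) 1, ∀ t ∈ Icc (0:ℝ) T,
      ∃ d1t d1x : ℝ,
        HasDerivWithinAt (fun s => ∫ y in (0:ℝ)..1, P1 x y s * u y s) d1t (Icc (0:ℝ) T) t ∧
        HasDerivWithinAt (fun s => ∫ y in (0:ℝ)..1, P1 s y t * u y t) d1x (Icc (0:ℝ) 1) x ∧
        -d1t = ε1 * d1x + c2 * (∫ y in (0:ℝ)..1, P2 x y t * v y t)
          + ∫ y in (0:ℝ)..1, Q1 x y * u y t := by
  intro x hx t ht
  obtain ⟨hud, huc, huxc, hutc⟩ := hu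
  obtain ⟨-, hvc, -, -⟩ := hv
  obtain ⟨hPd, hPc, hPxc, hPyc, hPtc⟩ := hP1
  obtain ⟨-, hP2c, -, -, -⟩ := hP2
  have hmt : MapsTo (fun p : ℝ × ℝ => (x, p.2, p.1)) (Icc (0:ℝ) T ×ˢ Icc (0:ℝ) 1)
      (Icc (0:ℝ) 1 ×ˢ Icc (0:ℝ) 1 ×ˢ Icc (0:ℝ) T) := fun p hp => ⟨hx, hp.2, hp.1⟩
  have hmx : MapsTo (fun p : ℝ × ℝ => (p.1, p.2, t)) (Icc (0:ℝ) 1 ×ˢ Icc (0:ℝ) 1)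
      (Icc (0:ℝ) 1 ×ˢ Icc (0:ℝ) 1 ×ˢ Icc (0:ℝ) T) := fun p hp => ⟨hp.1, hp.2, ht⟩
  have hmy : MapsTo (fun y : ℝ => (x, y, t)) (Icc (0:ℝ) 1)
      (Icc (0:ℝ) 1 ×ˢ Icc (0:ℝ) 1 ×ˢ Icc (0:ℝ) T) := fun y hy => ⟨hx, hy, ht⟩
  have hnt : MapsTo (fun p : ℝ × ℝ => (p.2, p.1)) (Icc (0:ℝ) T ×ˢ Icc (0:ℝ) 1)
      (Icc (0:ℝ) 1 ×ˢ Icc (0:ℝ) T) := fun p hp => ⟨hp.2, hp.1⟩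
  have hnx : MapsTo (fun p : ℝ × ℝ => (p.2, t)) (Icc (0:ℝ) 1 ×ˢ Icc (0:ℝ) 1)
      (Icc (0:ℝ) 1 ×ˢ Icc (0:ℝ) T) := fun p hp => ⟨hp.2, ht⟩
  have hny : MapsTo (fun y : ℝ => (y, t)) (Icc (0:ℝ) 1)
      (Icc (0:ℝ) 1 ×ˢ Icc (0:ℝ) T) := fun y hy => ⟨hy, ht⟩
  have hPy := hPc.comp (by fun_prop) hmy
  have huy := huc.comp (by fun_prop) hny
  have huxy := huxc.comp (by fun_prop) hny
  have hPyy := hPyc.comp (by fun_prop) hmy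
  have hPxy := hPxc.comp (by fun_prop) hmy
  have hQy : ContinuousOn (fun y => Q1 x y) (Icc 0 1) :=
    hQ1.comp (f := fun y => (x, y)) (by fun_prop) fun y hy => ⟨hx, hy⟩
  have iB : IntervalIntegrable (fun y => P1y x y t * u y t + P1 x y t * ux y t) volume 0 1 :=
    ((hPyy.mul huy).add (hPy.mul huxy)).intervalIntegrable_of_Icc zero_le_one
  have hboundary : ∫ y in (0:ℝ)..1, (P1y x y t * u y t + P1 x y t * ux y t) = 0 := by
    rw [integral_eq_sub_of_hasDerivAt_of_le (f := fun y => P1 x y t * u y t) zero_le_one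
      (hPy.mul huy)
      (fun y hy => ?_) iB]
    · simp [hP1bc1 x hx t ht, hP1bc0 x hx t ht]
    · have hy' := Ioo_subset_Icc_self hy
      exact ((hPd x hx y hy' t ht).2.1.mul (hud y hy' t ht).1).hasDerivAt
        (Icc_mem_nhds hy.1 hy.2)
  have iX : IntervalIntegrable (fun y => P1x x y t * u y t) volume 0 1 :=
    (hPxy.mul huy).intervalIntegrable_of_Icc zero_le_one
  have iV : IntervalIntegrable (fun y => P2 x y t * v y t) volume 0 1 :=
    ((hP2c.comp (by fun_prop) hmy).mul
      (hvc.comp (by fun_prop) hny)).intervalIntegrable_of_Icc zero_le_one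
  have iQ : IntervalIntegrable (fun y => Q1 x y * u y t) volume 0 1 :=
    (hQy.mul huy).intervalIntegrable_of_Icc zero_le_one
  refine ⟨∫ y in (0:ℝ)..1, (P1t x y t * u y t + P1 x y t * ut y t),
    ∫ y in (0:ℝ)..1, P1x x y t * u y t, ?_, ?_, ?_⟩
  · exact hasDerivWithinAt_intervalIntegral_of_continuousOn (F := fun s y => P1 x y s * u y s)
      (F' := fun s y => P1t x y s * u y s + P1 x y s * ut y s)
      (convex_Icc 0 T) isCompact_Icc zero_le_one
      ((hPc.comp (by fun_prop) hmt).mul (huc.comp (by fun_prop) hnt))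
      (((hPtc.comp (by fun_prop) hmt).mul (huc.comp (by fun_prop) hnt)).add
        ((hPc.comp (by fun_prop) hmt).mul (hutc.comp (by fun_prop) hnt)))
      (fun s hs y hy => (hPd x hx y hy s hs).2.2.mul (hud y hy s hs).2) ht
  · exact hasDerivWithinAt_intervalIntegral_of_continuousOn (F := fun s y => P1 s y t * u y t)
      (F' := fun s y => P1x s y t * u y t)
      (convex_Icc 0 1) isCompact_Icc zero_le_one
      ((hPc.comp (by fun_prop) hmx).mul (huc.comp (by fun_prop) hnx))
      ((hPxc.comp (by fun_prop) hmx).mul (huc.comp (by fun_prop) hnx))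
      (fun s hs y hy => (hPd s hs y hy t ht).1.mul_const (u y t)) hx
  · have hpt : ∀ y ∈ uIcc (0:ℝ) 1, -(P1t x y t * u y t + P1 x y t * ut y t) =
        ε1 * (P1y x y t * u y t + P1 x y t * ux y t) + ε1 * (P1x x y t * u y t)
          + c2 * (P2 x y t * v y t) + Q1 x y * u y t := by
      intro y hy
      rw [uIcc_of_le zero_le_one] at hy
      linear_combination u y t * hric1 x hx y hy t ht - P1 x y t * hpde1 y hy t ht
        - v y t * halg x hx y hy t ht
    rw [← intervalIntegral.integral_neg, integral_congr hpt,
      integral_add (((iB.const_mul _).add (iX.const_mul _)).add (iV.const_mul _)) iQ,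
      integral_add ((iB.const_mul _).add (iX.const_mul _)) (iV.const_mul _),
      integral_add (iB.const_mul _) (iX.const_mul _)]
    simp only [intervalIntegral.integral_const_mul, hboundary]
    ring
end
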